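/- Let O be an integral domain with fraction field F, Γ a finite abelian group with |Γ| invertible in O, R = O[Γ], and M a finitely generated R-module such that M̃ (the image of M in M ⊗_O F) is a projective R-module. Then for every r ≥ 0, the image of ∧^r M in (∧^r M) ⊗_O F equals the dual lattice Λ^r(M) := { m ∈ image of ∧^r M in (∧^r M) ⊗ F : Ψ(m) ∈ R for all Ψ ∈ ∧^r Hom_R(M,R) }, where Ψ acts by the determinant pairing. -/

import Mathlib

noncomputable section

open TensorProduct

variable (O : Type*) [CommRing O] [IsDomain O]
variable (Γ : Type*) [CommGroup Γ] [Fintype Γ]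
variable (M : Type*) [AddCommGroup M] [Module O M]
  [Module (MonoidAlgebra O Γ) M] [IsScalarTower O (MonoidAlgebra O Γ) M]

/-- The exterior algebra of `M` over the group ring `R = O[Γ]`, scalar-extended to the
fraction field `F` of `O` (tensored over `O`). -/
abbrev EAF :=
  TensorProduct O (FractionRing O) (ExteriorAlgebra (MonoidAlgebra O Γ) M)

/-- The natural map from the exterior algebra to its scalar extension to `F`. -/
def inclF (x : ExteriorAlgebra (MonoidAlgebra O Γ) M) : EAF O Γ M :=
  (1 : FractionRing O) ⊗ₜ[O] x

/-- Contraction (interior product) by a functional `d ∈ Hom_R(M,R)`, extended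
`F`-linearly to the scalar extension of the exterior algebra. -/
def contrF (d : Module.Dual (MonoidAlgebra O Γ) M) : EAF O Γ M →ₗ[O] EAF O Γ M :=
  LinearMap.lTensor (FractionRing O)
    ((CliffordAlgebra.contractLeft (Q := (0 : QuadraticForm (MonoidAlgebra O Γ) M)) d).restrictScalars O)

/-- Iterated contraction by a family of functionals (the first functional acts first);
on the image of `∧^n M` this is the determinant pairing with `∧^n M^*`. -/
def iterContr {n : ℕ} (φ : Fin n → Module.Dual (MonoidAlgebra O Γ) M) (x : EAF O Γ M) :
    EAF O Γ M :=
  (List.ofFn φ).foldl (fun y d => contrF O Γ M d y) x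

/-- The dual lattice `Λ^r(M) ⊂ (∧^r M) ⊗_O F`: elements of the `F`-span of the image of
`∧^r M` on which every `Ψ ∈ ∧^r M^*` (acting by the determinant/contraction pairing)
takes values in `R`. -/
def Lambda (r : ℕ) : Set (EAF O Γ M) :=
  {m | m ∈ Submodule.span (FractionRing O)
        (Set.range fun x : ↥(⋀[MonoidAlgebra O Γ]^r M) =>
          inclF O Γ M (x : ExteriorAlgebra (MonoidAlgebra O Γ) M)) ∧
    ∀ φ : Fin r → Module.Dual (MonoidAlgebra O Γ) M,
      iterContr O Γ M φ m ∈
        Set.range fun a : MonoidAlgebra O Γ =>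
          inclF O Γ M (algebraMap (MonoidAlgebra O Γ) (ExteriorAlgebra (MonoidAlgebra O Γ) M) a)}

section Helpers

theorem contract_iotaMulti {R N : Type*} [CommRing R] [AddCommGroup N] [Module R N]
    (d : Module.Dual R N) : ∀ (n : ℕ) (v : Fin (n + 1) → N),
    CliffordAlgebra.contractLeft (Q := (0 : QuadraticForm R N)) d
        (ExteriorAlgebra.ιMulti R (n + 1) v) =
      ∑ j : Fin (n + 1), ((-1) ^ (j : ℕ) * d (v j)) •
        ExteriorAlgebra.ιMulti R n (fun i => v (j.succAbove i)) := by
  intro n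
  induction n with
  | zero =>
    intro v
    rw [ExteriorAlgebra.ιMulti_succ_apply]
    erw [CliffordAlgebra.contractLeft_ι_mul]
    simp only [ExteriorAlgebra.ιMulti_zero_apply]
    erw [CliffordAlgebra.contractLeft_one]
    simp
  | succ n ih =>
    intro v
    rw [ExteriorAlgebra.ιMulti_succ_apply]
    erw [CliffordAlgebra.contractLeft_ι_mul]
    erw [ih]
    rw [Finset.mul_sum, Fin.sum_univ_succ (n := n + 1), sub_eq_add_neg, ← Finset.sum_neg_distrib]
    congr 1
    · simp [Matrix.vecTail, Function.comp_def]
    · refine Finset.sum_congr rfl fun j _ => ?_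
      rw [ExteriorAlgebra.ιMulti_succ_apply]
      erw [mul_smul_comm]
      rw [← neg_smul]
      congr 1
      · simp [Matrix.vecTail, pow_succ]
      · have h0 : v (j.succ.succAbove 0) = v 0 := by simp
        have h1 : (Matrix.vecTail fun i => v (j.succ.succAbove i)) =
            fun i => Matrix.vecTail v (j.succAbove i) := by
          ext i; simp [Matrix.vecTail]
        rw [h0, h1]

/-- iterated contraction on the exterior algebra -/
def iterC {R N : Type*} [CommRing R] [AddCommGroup N] [Module R N] :
    {n : ℕ} → (Fin n → Module.Dual R N) → (ExteriorAlgebra R N →ₗ[R] ExteriorAlgebra R N)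
  | 0, _ => LinearMap.id
  | _ + 1, φ => (iterC (fun i => φ i.succ)).comp
      (CliffordAlgebra.contractLeft (Q := (0 : QuadraticForm R N)) (φ 0))

theorem iterC_iotaMulti {R N : Type*} [CommRing R] [AddCommGroup N] [Module R N] :
    ∀ (n : ℕ) (φ : Fin n → Module.Dual R N) (v : Fin n → N),
    iterC φ (ExteriorAlgebra.ιMulti R n v) =
      algebraMap R _ (Matrix.det (Matrix.of fun i j => φ j (v i))) := by
  intro n
  induction n with
  | zero => intro φ v; simp [iterC]
  | succ n ih =>
    intro φ v
    simp only [iterC, LinearMap.comp_apply]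
    erw [contract_iotaMulti]
    rw [map_sum, Matrix.det_succ_column_zero, map_sum]
    refine Finset.sum_congr rfl fun j _ => ?_
    rw [map_smul, ih, Algebra.smul_def, ← map_mul]
    rfl

theorem iterC_mem {R N : Type*} [CommRing R] [AddCommGroup N] [Module R N]
    {n : ℕ} (φ : Fin n → Module.Dual R N) (z : ⋀[R]^n N) :
    ∃ a : R, iterC φ (z : ExteriorAlgebra R N) = algebraMap R _ a := by
  obtain ⟨z, hz⟩ := z
  simp only
  replace hz : z ∈ Submodule.span R (Set.range (ExteriorAlgebra.ιMulti R n)) := by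
    rwa [ExteriorAlgebra.ιMulti_span_fixedDegree]
  induction hz using Submodule.span_induction with
  | mem x hx => obtain ⟨v, rfl⟩ := hx; exact ⟨_, iterC_iotaMulti _ _ _⟩
  | zero => exact ⟨0, by simp⟩
  | add x y _ _ hx hy =>
    obtain ⟨a, ha⟩ := hx
    obtain ⟨b, hb⟩ := hy
    exact ⟨a + b, by simp [ha, hb]⟩
  | smul c x _ hx =>
    obtain ⟨a, ha⟩ := hx
    exact ⟨c * a, by rw [map_smul, ha, Algebra.smul_def, map_mul]⟩

/-- Cauchy–Binet style expansion. -/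
theorem expand {R N : Type*} [CommRing R] [AddCommGroup N] [Module R N] {k r : ℕ}
    (a : N →ₗ[R] (Fin k → R)) (b : (Fin k → R) →ₗ[R] N) (v : Fin r → N) :
    ExteriorAlgebra.ιMulti R r (fun i => b (a (v i))) =
      ∑ s : Set.powersetCard (Fin k) r,
        iterC (fun j => (LinearMap.proj (Set.powersetCard.ofFinEmbEquiv.symm s j)).comp a)
          (ExteriorAlgebra.ιMulti R r v) *
        (exteriorPower.ιMulti_family R r (fun i => b (Pi.single i 1)) s : ⋀[R]^r N) := by
  have h := ((Pi.basisFun R (Fin k)).exteriorPower r).sum_repr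
    (exteriorPower.ιMulti R r (fun i => a (v i)))
  have h2 := congrArg (fun z => ((exteriorPower.map r b z : ⋀[R]^r N) : ExteriorAlgebra R N)) h
  simp only [map_sum, map_smul, exteriorPower.basis_apply, exteriorPower.map_apply_ιMulti_family,
    exteriorPower.map_apply_ιMulti, exteriorPower.basis_repr_apply,
    exteriorPower.ιMultiDual_apply_ιMulti] at h2
  rw [exteriorPower.ιMulti_apply_coe] at h2
  refine Eq.trans ?_ (h2.symm.trans ?_)
  · rfl
  · rw [AddSubmonoidClass.coe_finsetSum]
    refine Finset.sum_congr rfl fun s _ => ?_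
    rw [iterC_iotaMulti, ← Algebra.smul_def]
    have : (⇑b ∘ ⇑(Pi.basisFun R (Fin k))) = fun i => b (Pi.single i 1) := by
      ext i; simp
    rw [this]
    rfl

theorem iterContr_eq {n : ℕ} (φ : Fin n → Module.Dual (MonoidAlgebra O Γ) M) (x : EAF O Γ M) :
    iterContr O Γ M φ x =
      LinearMap.baseChange (FractionRing O) ((iterC φ).restrictScalars O) x := by
  induction n generalizing x with
  | zero =>
    simp only [iterContr, List.ofFn_zero, List.foldl_nil]
    symm
    exact LinearMap.congr_fun (LinearMap.lTensor_id _ _) x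
  | succ n ih =>
    have := ih (fun i => φ i.succ) (contrF O Γ M (φ 0) x)
    rw [iterContr] at this ⊢
    rw [List.ofFn_succ, List.foldl_cons, this]
    unfold contrF
    exact (LinearMap.congr_fun (LinearMap.lTensor_comp (FractionRing O)
      ((iterC (fun i => φ i.succ)).restrictScalars O)
      ((CliffordAlgebra.contractLeft (Q := (0 : QuadraticForm (MonoidAlgebra O Γ) M))
        (φ 0)).restrictScalars O)) x).symm

theorem exists_smul_eq_of_tmul {O : Type*} [CommRing O] [IsDomain O] {N : Type*}
    [AddCommGroup N] [Module O N] {x y : N}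
    (h : x ⊗ₜ[O] (1 : FractionRing O) = y ⊗ₜ[O] (1 : FractionRing O)) :
    ∃ c : O, c ≠ 0 ∧ c • x = c • y := by
  have h1 : (1 : FractionRing O) ⊗ₜ[O] x = (1 : FractionRing O) ⊗ₜ[O] y := by
    simpa using congrArg (TensorProduct.comm O N (FractionRing O)) h
  have : IsLocalizedModule (nonZeroDivisors O) (TensorProduct.mk O (FractionRing O) N 1) :=
    (isLocalizedModule_iff_isBaseChange (nonZeroDivisors O) (FractionRing O) _).2
      (TensorProduct.isBaseChange O N (FractionRing O))
  obtain ⟨c, hc⟩ := (IsLocalizedModule.eq_iff_exists (nonZeroDivisors O)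
    (TensorProduct.mk O (FractionRing O) N 1)).1 h1
  exact ⟨c, nonZeroDivisors.ne_zero c.2, hc⟩

theorem tmul_eq_of_smul_eq {O : Type*} [CommRing O] [IsDomain O] {N : Type*}
    [AddCommGroup N] [Module O N] {x y : N} {c : O} (hc : c ≠ 0) (h : c • x = c • y) :
    (1 : FractionRing O) ⊗ₜ[O] x = (1 : FractionRing O) ⊗ₜ[O] y := by
  have hc' : algebraMap O (FractionRing O) c ≠ 0 := by
    simpa using hc
  have key : ∀ z : N, (1 : FractionRing O) ⊗ₜ[O] z =
      (algebraMap O (FractionRing O) c)⁻¹ ⊗ₜ[O] (c • z) := by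
    intro z
    rw [← TensorProduct.smul_tmul, Algebra.smul_def, mul_inv_cancel₀ hc']
  rw [key x, key y, h]

theorem inclF_iotaMulti_congr {r : ℕ} (v w : Fin r → M)
    (h : ∀ i, v i ⊗ₜ[O] (1 : FractionRing O) = w i ⊗ₜ[O] (1 : FractionRing O)) :
    inclF O Γ M (ExteriorAlgebra.ιMulti (MonoidAlgebra O Γ) r v) =
      inclF O Γ M (ExteriorAlgebra.ιMulti (MonoidAlgebra O Γ) r w) := by
  choose c hc0 hc using fun i => exists_smul_eq_of_tmul (h i)
  refine tmul_eq_of_smul_eq (c := ∏ i, c i) (Finset.prod_ne_zero_iff.2 fun i _ => hc0 i) ?_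
  have key : ∀ u : Fin r → M, (∏ i, c i) • ExteriorAlgebra.ιMulti (MonoidAlgebra O Γ) r u =
      ExteriorAlgebra.ιMulti (MonoidAlgebra O Γ) r (fun i => c i • u i) := by
    intro u
    have h1 : (fun i => c i • u i) =
        fun i => algebraMap O (MonoidAlgebra O Γ) (c i) • u i := by
      ext i; rw [algebraMap_smul]
    rw [h1, AlternatingMap.map_smul_univ, ← map_prod, algebraMap_smul]
  rw [key, key]
  congr 1
  ext i
  exact hc i

theorem exists_split [SMulCommClass O (MonoidAlgebra O Γ) M] [Module.Finite (MonoidAlgebra O Γ) M]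
    (hproj : Module.Projective (MonoidAlgebra O Γ)
      ↥(Submodule.span (MonoidAlgebra O Γ)
        (Set.range fun x : M => x ⊗ₜ[O] (1 : FractionRing O)))) :
    ∃ (k : ℕ) (a : M →ₗ[MonoidAlgebra O Γ] (Fin k → MonoidAlgebra O Γ))
      (b : (Fin k → MonoidAlgebra O Γ) →ₗ[MonoidAlgebra O Γ] M),
      ∀ m, b (a m) ⊗ₜ[O] (1 : FractionRing O) = m ⊗ₜ[O] (1 : FractionRing O) := by
  obtain ⟨k, b, hb⟩ := Module.Finite.exists_fin' (MonoidAlgebra O Γ) M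
  let π₀ : M →ₗ[MonoidAlgebra O Γ] M ⊗[O] FractionRing O :=
    { toFun := fun m => m ⊗ₜ[O] (1 : FractionRing O)
      map_add' := fun x y => TensorProduct.add_tmul _ _ _
      map_smul' := fun c x => rfl }
  have hr : ∀ m, π₀ m ∈ Submodule.span (MonoidAlgebra O Γ)
        (Set.range fun x : M => x ⊗ₜ[O] (1 : FractionRing O)) :=
    fun m => Submodule.subset_span ⟨m, rfl⟩
  let π := LinearMap.codRestrict _ π₀ hr
  have hπ : Function.Surjective π := by
    rintro ⟨y, hy⟩
    have : y ∈ LinearMap.range π₀ := by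
      refine Submodule.span_le.2 ?_ hy
      rintro _ ⟨x, rfl⟩
      exact ⟨x, rfl⟩
    obtain ⟨x, hx⟩ := this
    exact ⟨x, Subtype.ext hx⟩
  obtain ⟨t, ht⟩ := Module.projective_lifting_property (π.comp b) LinearMap.id
    (by rw [LinearMap.coe_comp]; exact hπ.comp hb)
  refine ⟨k, t.comp π, b, fun m => ?_⟩
  exact congrArg Subtype.val (LinearMap.congr_fun ht (π m))

end Helpers

/-- Let `O` be an integral domain with fraction field `F`, `Γ` a finite
abelian group with `|Γ|` invertible in `O`, `R = O[Γ]`, and `M` a finitely generated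
`R`-module such that `M̃` (the image of `M` in `M ⊗_O F`) is a projective `R`-module.
Then for every `r ≥ 0`, the image of `∧^r M` in `(∧^r M) ⊗_O F` equals the dual
lattice `Λ^r(M)`. -/
theorem image_eq_dual_lattice
    [SMulCommClass O (MonoidAlgebra O Γ) M] [Module.Finite (MonoidAlgebra O Γ) M]
    (hcard : IsUnit (Fintype.card Γ : O))
    (hproj : Module.Projective (MonoidAlgebra O Γ)
      ↥(Submodule.span (MonoidAlgebra O Γ)
        (Set.range fun x : M => x ⊗ₜ[O] (1 : FractionRing O))))
    (r : ℕ) :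
    (Set.range fun x : ↥(⋀[MonoidAlgebra O Γ]^r M) =>
        inclF O Γ M (x : ExteriorAlgebra (MonoidAlgebra O Γ) M)) =
      Lambda O Γ M r := by
  simp only [Lambda]
  apply Set.Subset.antisymm
  · rintro _ ⟨x, rfl⟩
    refine ⟨Submodule.subset_span ⟨x, rfl⟩, fun φ => ?_⟩
    obtain ⟨a, ha⟩ := iterC_mem φ x
    refine ⟨a, ?_⟩
    simp only
    rw [iterContr_eq, ← ha]
    rfl
  · rintro y ⟨hy, hφ⟩
    obtain ⟨k, a, b, hab⟩ := exists_split O Γ M hproj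
    let ψ (s : Set.powersetCard (Fin k) r) : Fin r → Module.Dual (MonoidAlgebra O Γ) M :=
      fun j => (LinearMap.proj (Set.powersetCard.ofFinEmbEquiv.symm s j)).comp a
    let e (s : Set.powersetCard (Fin k) r) : ⋀[MonoidAlgebra O Γ]^r M :=
      exteriorPower.ιMulti_family (MonoidAlgebra O Γ) r (fun i => b (Pi.single i 1)) s
    let T : ExteriorAlgebra (MonoidAlgebra O Γ) M →ₗ[MonoidAlgebra O Γ]
        ExteriorAlgebra (MonoidAlgebra O Γ) M :=
      ∑ s, (LinearMap.mulRight (MonoidAlgebra O Γ)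
        (e s : ExteriorAlgebra (MonoidAlgebra O Γ) M)).comp (iterC (ψ s))
    have hT : ∀ z : ⋀[MonoidAlgebra O Γ]^r M,
        inclF O Γ M (T (z : ExteriorAlgebra (MonoidAlgebra O Γ) M)) = inclF O Γ M z := by
      rintro ⟨z, hz'⟩
      simp only
      have hz : z ∈ Submodule.span (MonoidAlgebra O Γ)
          (Set.range (ExteriorAlgebra.ιMulti (MonoidAlgebra O Γ) r)) := by
        rwa [ExteriorAlgebra.ιMulti_span_fixedDegree]
      clear hz'
      induction hz using Submodule.span_induction with
      | mem x hx =>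
        obtain ⟨v, rfl⟩ := hx
        rw [← inclF_iotaMulti_congr O Γ M (fun i => b (a (v i))) v (fun i => hab (v i)),
          expand a b v]
        simp only [T, LinearMap.sum_apply]
        rfl
      | zero => simp
      | add x y _ _ hx hy =>
        simp only [inclF, map_add, TensorProduct.tmul_add] at hx hy ⊢
        rw [hx, hy]
      | smul c x _ hx =>
        have h := congrArg (LinearMap.lTensor (FractionRing O)
          (LinearMap.mulLeft O (algebraMap (MonoidAlgebra O Γ)
            (ExteriorAlgebra (MonoidAlgebra O Γ) M) c))) hx
        simp only [inclF, LinearMap.lTensor_tmul, LinearMap.mulLeft_apply,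
          ← Algebra.smul_def] at h
        rw [map_smul]
        exact h
    have hTy : (T.restrictScalars O).baseChange (FractionRing O) y = y := by
      clear hφ
      induction hy using Submodule.span_induction with
      | mem x hx => obtain ⟨z, rfl⟩ := hx; exact hT z
      | zero => simp
      | add x y _ _ hx hy => rw [map_add, hx, hy]
      | smul c x _ hx => rw [map_smul, hx]
    choose α hα using fun s => hφ (ψ s)
    have hT2 : ∀ w : EAF O Γ M, (T.restrictScalars O).baseChange (FractionRing O) w =
        ∑ s, ((LinearMap.mulRight (MonoidAlgebra O Γ)
          (e s : ExteriorAlgebra (MonoidAlgebra O Γ) M)).restrictScalars O).baseChange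
            (FractionRing O) (iterContr O Γ M (ψ s) w) := by
      intro w
      induction w using TensorProduct.induction_on with
      | zero => simp [iterContr_eq]
      | add x y hx hy =>
        rw [map_add, hx, hy, ← Finset.sum_add_distrib]
        simp only [iterContr_eq, map_add]
      | tmul f x =>
        simp only [iterContr_eq, LinearMap.baseChange_tmul, T, LinearMap.restrictScalars_apply,
          LinearMap.sum_apply, TensorProduct.tmul_sum, LinearMap.comp_apply]
    refine ⟨∑ s, α s • e s, ?_⟩
    rw [← hTy, hT2]
    simp only [← hα, inclF, AddSubmonoidClass.coe_finsetSum, TensorProduct.tmul_sum]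
    refine Finset.sum_congr rfl fun s _ => ?_
    rw [LinearMap.baseChange_tmul, LinearMap.restrictScalars_apply, LinearMap.mulRight_apply,
      ← Algebra.smul_def]
    rfl
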